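/- Let n ≥ 2, s > 0, β > 0, m > s be an integer, a = (a_1,…,a_n) ∈ ℝ^n with a_i > 0, and i, j ∈ {1,…,n}. Then for every x ∈ E_a, (L_{m,s}(y ↦ y_i y_j u_β(y)))(x) = (1/(2(β+1)a_i)) · ( δ_{ij} (L_{m,s} u_{β+1})(x) + (1/(2(β+2)a_j)) ∂_i ∂_j (L_{m,s} u_{β+2})(x) ), where δ_{ij} is the Kronecker delta and ∂_i, ∂_j denote partial derivatives of the function x ↦ (L_{m,s} u_{β+2})(x). -/

import Mathlib

open MeasureTheory Finset Filter
open scoped BigOperators NNReal ENNReal FourierTransform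

noncomputable section

/-- Finite difference of order `2m`:
`δ_m u(x,y) = ∑_{k=-m}^m (-1)^k binom(2m, m-k) u(x + k y)`. -/
def finDiff (n m : ℕ) (u : EuclideanSpace ℝ (Fin n) → ℝ) (x y : EuclideanSpace ℝ (Fin n)) : ℝ :=
  ∑ k ∈ Finset.Icc (-(m : ℤ)) (m : ℤ),
    (-1 : ℝ) ^ k * (Nat.choose (2 * m) ((m : ℤ) - k).toNat : ℝ) * u (x + (k : ℝ) • y)

open Classical in
/-- The normalizing constant `c_{n,m,s}`. -/
def cnms (n m : ℕ) (s : ℝ) : ℝ :=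
  if ∃ j : ℕ, s = (j : ℝ) then
    (4 : ℝ) ^ s * Real.Gamma ((n : ℝ) / 2 + s) * Real.Gamma (s + 1) /
        (2 * Real.pi ^ ((n : ℝ) / 2)) *
      (∑ k ∈ Finset.Icc 2 m, (-1 : ℝ) ^ (k + 1 + ⌊s⌋₊) * (Nat.choose (2 * m) (m - k) : ℝ) *
          (k : ℝ) ^ (2 * s) * Real.log (k : ℝ))⁻¹
  else
    (4 : ℝ) ^ s * Real.Gamma ((n : ℝ) / 2 + s) /
        (Real.pi ^ ((n : ℝ) / 2) * Real.Gamma (-s)) *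
      (∑ k ∈ Finset.Icc 1 m, (-1 : ℝ) ^ k * (Nat.choose (2 * m) (m - k) : ℝ) *
          (k : ℝ) ^ (2 * s))⁻¹

/-- Pointwise hypersingular-integral realization `L_{m,s}` of the fractional
Laplacian `(-Δ)^s`. -/
def Lms (n m : ℕ) (s : ℝ) (u : EuclideanSpace ℝ (Fin n) → ℝ)
    (x : EuclideanSpace ℝ (Fin n)) : ℝ :=
  cnms n m s / 2 * ∫ y : EuclideanSpace ℝ (Fin n), finDiff n m u x y / ‖y‖ ^ ((n : ℝ) + 2 * s)

/-- `|x|_a² = ∑ aᵢ xᵢ²`. -/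
def qa (n : ℕ) (a : Fin n → ℝ) (x : EuclideanSpace ℝ (Fin n)) : ℝ := ∑ i, a i * x i ^ 2

/-- The open ellipsoid `E_a`. -/
def Ea (n : ℕ) (a : Fin n → ℝ) : Set (EuclideanSpace ℝ (Fin n)) := {x | qa n a x < 1}

/-- `u_β(x) = (1 - |x|_a²)₊^β`. -/
def uPow (n : ℕ) (a : Fin n → ℝ) (β : ℝ) (x : EuclideanSpace ℝ (Fin n)) : ℝ :=
  max 0 (1 - qa n a x) ^ β

/-- `⟨x, θ⟩_a = ∑ aᵢ xᵢ θᵢ`. -/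
def aInner (n : ℕ) (a : Fin n → ℝ) (x θ : EuclideanSpace ℝ (Fin n)) : ℝ :=
  ∑ i, a i * x i * θ i

/-- `Aθ` for `A = diag a`. -/
def Avec (n : ℕ) (a : Fin n → ℝ) (θ : EuclideanSpace ℝ (Fin n)) : EuclideanSpace ℝ (Fin n) :=
  (WithLp.equiv 2 (Fin n → ℝ)).symm fun i => a i * θ i

/-- `∫_{∂E_a} f dμ`, where `μ(dθ) = dθ / (|θ|^{n+2s} |Aθ|)` and `dθ` is the
`(n-1)`-dimensional Hausdorff (surface) measure on `∂E_a`. -/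
def surfInt (n : ℕ) (s : ℝ) (a : Fin n → ℝ) (f : EuclideanSpace ℝ (Fin n) → ℝ) : ℝ :=
  ∫ θ in {θ : EuclideanSpace ℝ (Fin n) | qa n a θ = 1},
    f θ / (‖θ‖ ^ ((n : ℝ) + 2 * s) * ‖Avec n a θ‖) ∂(μH[(n : ℝ) - 1])

/-- `k_{n,s} = 2^{2s-1} Γ(n/2+s) / π^{n/2}`. -/
def kns (n : ℕ) (s : ℝ) : ℝ :=
  (2 : ℝ) ^ (2 * s - 1) * Real.Gamma ((n : ℝ) / 2 + s) / Real.pi ^ ((n : ℝ) / 2)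

/-- `J₀ = ∫_{∂E_a} μ(dθ)`. -/
def J0fun (n : ℕ) (s : ℝ) (a : Fin n → ℝ) : ℝ := surfInt n s a fun _ => 1

/-- `J_i^{(k)} = a_k^i ∫_{∂E_a} θ_k^{2i} μ(dθ)`. -/
def Jik (n : ℕ) (s : ℝ) (a : Fin n → ℝ) (i : ℕ) (k : Fin n) : ℝ :=
  a k ^ i * surfInt n s a fun θ => θ k ^ (2 * i)

/-- Gauss hypergeometric function `₂F₁(α, β; γ; z)`. -/
def hyp2F1 (α β γ z : ℝ) : ℝ :=
  ∑' k : ℕ, (ascPochhammer ℝ k).eval α * (ascPochhammer ℝ k).eval β /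
      ((ascPochhammer ℝ k).eval γ * (Nat.factorial k : ℝ)) * z ^ k

/-- The weight vector `(1, …, 1, a)`. -/
def avec (n : ℕ) (a : ℝ) : Fin n → ℝ := fun i => if (i : ℕ) = n - 1 then a else 1

/-- Beta function `B(x,y) = Γ(x)Γ(y)/Γ(x+y)`. -/
def realBeta (x y : ℝ) : ℝ := Real.Gamma x * Real.Gamma y / Real.Gamma (x + y)

/-- Surface measure `ω_d = 2 π^{(d+1)/2} / Γ((d+1)/2)` of the unit `d`-sphere. -/
def sphVol (d : ℝ) : ℝ := 2 * Real.pi ^ ((d + 1) / 2) / Real.Gamma ((d + 1) / 2)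

/-- Point inversion `σ(x) = c (x+ν)/|x+ν|² - ν`. -/
def ptInv (n : ℕ) (c : ℝ) (ν x : EuclideanSpace ℝ (Fin n)) : EuclideanSpace ℝ (Fin n) :=
  (c / ‖x + ν‖ ^ 2) • (x + ν) - ν

/-- `Ω(a,c,ν) = σ(E_a)` (the set of `x ≠ -ν` with `σ(x) ∈ E_a`). -/
def Omg (n : ℕ) (c : ℝ) (ν : EuclideanSpace ℝ (Fin n)) (a : Fin n → ℝ) :
    Set (EuclideanSpace ℝ (Fin n)) :=
  {x | x ≠ -ν ∧ qa n a (ptInv n c ν x) < 1}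

open Classical in
/-- The transformed torsion function `w_s(x) = |x+ν|^{2s-n} u_s(σ(x))`, extended by `0` at `-ν`. -/
def ws (n : ℕ) (s c : ℝ) (ν : EuclideanSpace ℝ (Fin n)) (a : Fin n → ℝ)
    (x : EuclideanSpace ℝ (Fin n)) : ℝ :=
  if x = -ν then 0 else ‖x + ν‖ ^ (2 * s - (n : ℝ)) * uPow n a s (ptInv n c ν x)

/-- `(Ax)·y` for a general matrix `A`. -/
def qA (n : ℕ) (A : Matrix (Fin n) (Fin n) ℝ) (x y : EuclideanSpace ℝ (Fin n)) : ℝ :=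
  ∑ i, ∑ j, A i j * x j * y i


/-- An iterated unit-step forward difference is bounded by the top derivative. -/
theorem norm_fwdDiff_iter_le_of_hasDerivAt {F : Type*} [NormedAddCommGroup F] [NormedSpace ℝ F]
    {C : ℝ} (N : ℕ) (G : ℕ → ℝ → F) (a : ℝ)
    (hG : ∀ k < N, ∀ t ∈ Set.Icc a (a + N), HasDerivAt (G k) (G (k + 1) t) t)
    (hC : ∀ t ∈ Set.Icc a (a + N), ‖G N t‖ ≤ C) :
    ‖(fwdDiff (1 : ℝ))^[N] (G 0) a‖ ≤ C := by
  induction N generalizing G with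
  | zero => simpa using hC a (by simp)
  | succ N ih =>
    rw [Function.iterate_succ_apply]
    have hsub : ∀ t ∈ Set.Icc a (a + N), Set.Icc t (t + 1) ⊆ Set.Icc a (a + (N + 1 : ℕ)) := by
      intro t ht r hr
      push_cast
      exact ⟨ht.1.trans hr.1, by linarith [ht.2, hr.2]⟩
    refine ih (fun k => fwdDiff (1 : ℝ) (G k)) (fun k hk t ht => ?_) (fun t ht => ?_)
    · refine HasDerivAt.sub (HasDerivAt.comp_add_const t 1 ?_) ?_
      · exact hG k (by omega) _ (hsub t ht (by simp))
      · exact hG k (by omega) _ (hsub t ht (by simp))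
    · have := norm_image_sub_le_of_norm_deriv_le_segment'
        (fun r hr => (hG N (by omega) r (hsub t ht hr)).hasDerivWithinAt)
        (fun r hr => hC r (hsub t ht (Set.Ico_subset_Icc_self hr))) (t + 1) (by simp)
      simpa [fwdDiff] using this

/-- Along short segments near a point of smoothness, `N`-th order differences are `O(‖y‖ ^ N)`. -/
theorem ContDiffAt.exists_norm_fwdDiff_iter_le {E : Type*} [NormedAddCommGroup E]
    [NormedSpace ℝ E] {N : ℕ} {w : E → ℝ} {x₀ : E} (hw : ContDiffAt ℝ N w x₀) :
    ∃ δ > 0, ∃ C, 0 ≤ C ∧ ∀ x y, (∀ t ∈ Set.Icc (0 : ℝ) N, x + t • y ∈ Metric.ball x₀ δ) →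
      |(fwdDiff (1 : ℝ))^[N] (fun t => w (x + t • y)) 0| ≤ C * ‖y‖ ^ N := by
  have hcont : ContinuousAt (iteratedFDeriv ℝ N w) x₀ :=
    (hw.iteratedFDeriv_right (m := 0) (i := N) (by simp)).continuousAt
  have hbd : ∀ᶠ z in nhds x₀, ‖iteratedFDeriv ℝ N w z‖ < ‖iteratedFDeriv ℝ N w x₀‖ + 1 :=
    hcont.norm.eventually_lt_const (by linarith)
  obtain ⟨δ, hδ, hball⟩ := Metric.eventually_nhds_iff_ball.1
    ((hw.eventually (by simp)).and hbd)
  refine ⟨δ, hδ, ‖iteratedFDeriv ℝ N w x₀‖ + 1, by positivity, fun x y hxy => ?_⟩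
  have key := norm_fwdDiff_iter_le_of_hasDerivAt (C := (‖iteratedFDeriv ℝ N w x₀‖ + 1) * ‖y‖ ^ N) N
    (fun k t => iteratedFDeriv ℝ k w (x + t • y) (fun _ => y)) 0 ?_ ?_
  · simpa using key
  · intro k hk t ht
    have hd : HasFDerivAt (iteratedFDeriv ℝ k w) (fderiv ℝ (iteratedFDeriv ℝ k w) (x + t • y))
        (x + t • y) :=
      ((hball _ (hxy t (by simpa using ht))).1.differentiableAt_iteratedFDeriv
        (by exact_mod_cast hk)).hasFDerivAt
    have hl : HasDerivAt (fun r : ℝ => x + r • y) y t := by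
      simpa using ((hasDerivAt_id t).smul_const y).const_add x
    have := hd.comp_hasDerivAt t hl
    have h2 := ((ContinuousMultilinearMap.apply ℝ (fun _ : Fin k => E) ℝ
      (fun _ => y)).hasFDerivAt).comp_hasDerivAt t this
    simpa [iteratedFDeriv_succ_apply_left, Function.comp_def, Fin.tail_def] using! h2
  · intro t ht
    refine ((iteratedFDeriv ℝ N w (x + t • y)).le_opNorm _).trans ?_
    rw [Finset.prod_const, Finset.card_univ, Fintype.card_fin]
    gcongr
    exact (hball _ (hxy t (by simpa using ht))).2.le

theorem finDiff_eq_fwdDiff (n m : ℕ) (u : EuclideanSpace ℝ (Fin n) → ℝ)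
    (x y : EuclideanSpace ℝ (Fin n)) :
    finDiff n m u x y =
      (-1) ^ m * (fwdDiff (1 : ℝ))^[2 * m] (fun t => u (x - (m : ℝ) • y + t • y)) 0 := by
  rw [fwdDiff_iter_eq_sum_shift, finDiff, Finset.mul_sum]
  symm
  refine Finset.sum_bij (fun k _ => (k : ℤ) - m) (fun k hk => ?_) (fun k _ l _ h => ?_)
    (fun k hk => ?_) (fun k hk => ?_)
  · simp only [Finset.mem_range, Finset.mem_Icc] at hk ⊢
    omega
  · simpa using h
  · simp only [Finset.mem_Icc] at hk
    exact ⟨(k + m).toNat, by simp only [Finset.mem_range]; omega, by omega⟩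
  · simp only [Finset.mem_range] at hk
    have hk' : k ≤ 2 * m := by omega
    have h1 : ((m : ℤ) - ((k : ℤ) - m)).toNat = 2 * m - k := by omega
    have h2 : (-1 : ℝ) ^ ((k : ℤ) - m) = (-1) ^ m * (-1) ^ (2 * m - k) := by
      have h3 : (m : ℤ) + (2 * m - k : ℕ) = (k - m) + 2 * (2 * m - k) := by omega
      rw [← zpow_natCast, ← zpow_natCast, ← zpow_add₀ (by norm_num), h3,
        zpow_add₀ (by norm_num), zpow_mul]
      norm_num
    have h4 : x - (m : ℝ) • y + (0 + k • (1 : ℝ)) • y = x + (((k : ℤ) - m : ℤ) : ℝ) • y := by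
      push_cast
      module
    rw [h1, h2, h4, Nat.choose_symm hk', zsmul_eq_mul]
    push_cast
    ring

theorem continuous_finDiff {n m : ℕ} {u : EuclideanSpace ℝ (Fin n) → ℝ} (hu : Continuous u)
    (x : EuclideanSpace ℝ (Fin n)) : Continuous (finDiff n m u x) := by
  unfold finDiff
  fun_prop

/-- Truncated power weights that dominate the hypersingular integrand are integrable. -/
theorem integrable_min_pow_div_rpow {n m : ℕ} {s : ℝ} (hn : 0 < n) (hs : 0 < s) (hm : s < m) :
    Integrable fun y : EuclideanSpace ℝ (Fin n) =>
      min (‖y‖ ^ (2 * m)) 1 / ‖y‖ ^ ((n : ℝ) + 2 * s) := by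
  have : NeZero n := ⟨hn.ne'⟩
  rw [integrable_fun_norm_addHaar volume
    (f := fun r : ℝ => min (r ^ (2 * m)) 1 / r ^ ((n : ℝ) + 2 * s)), finrank_euclideanSpace_fin,
    ← Set.Ioc_union_Ioi_eq_Ioi zero_le_one, integrableOn_union]
  have hpow : ∀ r : ℝ, 0 < r → r ^ (n - 1) = r ^ ((n : ℝ) - 1) := fun r hr => by
    rw [← Real.rpow_natCast, Nat.cast_sub hn, Nat.cast_one]
  constructor
  · have h : IntegrableOn (fun r : ℝ => r ^ (2 * m - 2 * s - 1)) (Set.Ioc 0 1) := by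
      rw [← intervalIntegrable_iff_integrableOn_Ioc_of_le zero_le_one]
      exact intervalIntegral.intervalIntegrable_rpow' (by linarith)
    refine h.congr_fun (fun r hr => ?_) measurableSet_Ioc
    have hr0 : 0 < r := hr.1
    simp only [smul_eq_mul]
    rw [min_eq_left (pow_le_one₀ hr0.le hr.2), hpow r hr0, ← Real.rpow_natCast r (2 * m),
      ← Real.rpow_sub hr0, ← Real.rpow_add hr0]
    congr 1
    push_cast
    ring
  · have h : IntegrableOn (fun r : ℝ => r ^ (- 2 * s - 1)) (Set.Ioi 1) :=
      integrableOn_Ioi_rpow_of_lt (by linarith) one_pos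
    refine h.congr_fun (fun r hr => ?_) measurableSet_Ioi
    have hr1 : 1 < r := hr
    have hr0 : 0 < r := one_pos.trans hr1
    simp only [smul_eq_mul]
    rw [min_eq_right (one_le_pow₀ hr1.le), hpow r hr0, one_div, ← Real.rpow_neg hr0.le,
      ← Real.rpow_add hr0]
    congr 1
    ring

theorem abs_finDiff_le {n m : ℕ} {u : EuclideanSpace ℝ (Fin n) → ℝ} {M : ℝ}
    (hM : ∀ z, ‖u z‖ ≤ M) (x y : EuclideanSpace ℝ (Fin n)) :
    |finDiff n m u x y| ≤ (∑ k ∈ Finset.Icc (-(m : ℤ)) (m : ℤ),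
      (Nat.choose (2 * m) ((m : ℤ) - k).toNat : ℝ)) * M := by
  rw [finDiff, Finset.sum_mul]
  refine (Finset.abs_sum_le_sum_abs _ _).trans (Finset.sum_le_sum fun k _ => ?_)
  rw [abs_mul, abs_mul, abs_zpow, abs_neg, abs_one, one_zpow, one_mul, Nat.abs_cast]
  exact mul_le_mul_of_nonneg_left (hM _) (Nat.cast_nonneg _)

/-- A bounded function that is smooth near `x₀` has finite differences controlled uniformly for
base points near `x₀`. -/
theorem exists_abs_finDiff_le {n m : ℕ} {u : EuclideanSpace ℝ (Fin n) → ℝ}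
    {x₀ : EuclideanSpace ℝ (Fin n)} (hu : ContDiffAt ℝ (2 * m : ℕ) u x₀)
    (hb : ∃ M, ∀ z, ‖u z‖ ≤ M) :
    ∃ K, ∀ᶠ x in nhds x₀, ∀ y, |finDiff n m u x y| ≤ K * min (‖y‖ ^ (2 * m)) 1 := by
  obtain ⟨M, hM⟩ := hb
  obtain ⟨δ, hδ, C, hC, hdiff⟩ := hu.exists_norm_fwdDiff_iter_le
  set S : ℝ := (∑ k ∈ Finset.Icc (-(m : ℤ)) (m : ℤ),
      (Nat.choose (2 * m) ((m : ℤ) - k).toNat : ℝ)) * M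
  have hS0 : 0 ≤ S := mul_nonneg (Finset.sum_nonneg fun _ _ => Nat.cast_nonneg _)
    ((norm_nonneg _).trans (hM x₀))
  set η : ℝ := min 1 (δ / (2 * (m + 1)))
  have hη0 : 0 < η := by positivity
  have hηm : m * η < δ / 2 := by
    have h1 : η ≤ δ / (2 * (m + 1)) := min_le_right _ _
    calc (m : ℝ) * η < (m + 1) * η := by linarith
      _ ≤ (m + 1) * (δ / (2 * (m + 1))) := by gcongr
      _ = δ / 2 := by field_simp
  refine ⟨C + S / η ^ (2 * m), ?_⟩
  filter_upwards [Metric.ball_mem_nhds x₀ (half_pos hδ)] with x hx y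
  have hSη : 0 ≤ S / η ^ (2 * m) := by positivity
  rcases le_or_gt ‖y‖ η with hy | hy
  · have hy1 : ‖y‖ ^ (2 * m) ≤ 1 := pow_le_one₀ (norm_nonneg _) (hy.trans (min_le_left _ _))
    rw [min_eq_left hy1, finDiff_eq_fwdDiff, abs_mul, abs_pow, abs_neg, abs_one, one_pow, one_mul]
    refine (hdiff _ y fun t ht => ?_).trans (by gcongr; linarith)
    push_cast at ht
    have h2 : |t - m| ≤ m := abs_le.2 ⟨by linarith [ht.1], by linarith [ht.2]⟩
    rw [Metric.mem_ball, dist_eq_norm] at hx ⊢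
    calc ‖x - (m : ℝ) • y + t • y - x₀‖ = ‖(x - x₀) + (t - m) • y‖ := by congr 1; module
      _ ≤ ‖x - x₀‖ + ‖(t - m) • y‖ := norm_add_le _ _
      _ ≤ ‖x - x₀‖ + m * η := by
        rw [norm_smul, Real.norm_eq_abs]
        gcongr
      _ < δ := by linarith
  · have h1 : η ^ (2 * m) ≤ min (‖y‖ ^ (2 * m)) 1 :=
      le_min (by gcongr) (pow_le_one₀ hη0.le (min_le_left _ _))
    calc |finDiff n m u x y| ≤ S := abs_finDiff_le hM x y
      _ = S / η ^ (2 * m) * η ^ (2 * m) := by field_simp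
      _ ≤ (C + S / η ^ (2 * m)) * min (‖y‖ ^ (2 * m)) 1 := by
        gcongr
        linarith

theorem integrable_finDiff {n m : ℕ} {s : ℝ} (hn : 0 < n) (hs : 0 < s) (hm : s < m)
    {u : EuclideanSpace ℝ (Fin n) → ℝ} {x₀ : EuclideanSpace ℝ (Fin n)} (hc : Continuous u)
    (hu : ContDiffAt ℝ (2 * m : ℕ) u x₀) (hb : ∃ M, ∀ z, ‖u z‖ ≤ M) :
    Integrable fun y => finDiff n m u x₀ y / ‖y‖ ^ ((n : ℝ) + 2 * s) := by
  obtain ⟨K, hK⟩ := exists_abs_finDiff_le hu hb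
  refine ((integrable_min_pow_div_rpow hn hs hm).const_mul K).mono'
    ((continuous_finDiff hc x₀).measurable.div
      (measurable_norm.pow_const _)).aestronglyMeasurable (ae_of_all _ fun y => ?_)
  rw [Real.norm_eq_abs, abs_div, abs_of_nonneg (a := ‖y‖ ^ _) (by positivity), ← mul_div_assoc]
  gcongr
  exact hK.self_of_nhds y

theorem hasFDerivAt_finDiff {n m : ℕ} {v : EuclideanSpace ℝ (Fin n) → ℝ}
    {w : Fin n → EuclideanSpace ℝ (Fin n) → ℝ}
    (hv : ∀ z, HasFDerivAt v (∑ j, w j z • EuclideanSpace.proj (𝕜 := ℝ) j) z)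
    (x y : EuclideanSpace ℝ (Fin n)) :
    HasFDerivAt (fun x => finDiff n m v x y)
      (∑ j, finDiff n m (w j) x y • EuclideanSpace.proj (𝕜 := ℝ) j) x := by
  unfold finDiff
  have h : ∀ k ∈ Finset.Icc (-(m : ℤ)) (m : ℤ), HasFDerivAt
      (fun x => (-1 : ℝ) ^ k * (Nat.choose (2 * m) ((m : ℤ) - k).toNat : ℝ) * v (x + (k : ℝ) • y))
      (((-1 : ℝ) ^ k * (Nat.choose (2 * m) ((m : ℤ) - k).toNat : ℝ)) •
        ∑ j, w j (x + (k : ℝ) • y) • EuclideanSpace.proj (𝕜 := ℝ) j) x := fun k _ =>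
    (((hv (x + (k : ℝ) • y)).comp x ((hasFDerivAt_id x).add_const _)).const_mul _)
  refine (HasFDerivAt.fun_sum h).congr_fderiv ?_
  simp only [Finset.smul_sum, Finset.sum_smul, smul_smul]
  rw [Finset.sum_comm]

theorem integrable_sum_smul_const {α ι W : Type*} [MeasurableSpace α] {μ : Measure α} [Fintype ι]
    [NormedAddCommGroup W] [NormedSpace ℝ W] {f : ι → α → ℝ} (hf : ∀ j, Integrable (f j) μ)
    (c : ι → W) : Integrable (fun y => ∑ j, f j y • c j) μ :=
  integrable_finsetSum _ fun j _ => (hf j).smul_const _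

/-- The hypersingular integral commutes with partial derivatives at points of smoothness. -/
theorem fderiv_Lms_single {n m : ℕ} {s : ℝ} (hn : 0 < n) (hs : 0 < s) (hm : s < m)
    {v : EuclideanSpace ℝ (Fin n) → ℝ} {w : Fin n → EuclideanSpace ℝ (Fin n) → ℝ}
    {x₀ : EuclideanSpace ℝ (Fin n)}
    (hv : ∀ z, HasFDerivAt v (∑ j, w j z • EuclideanSpace.proj (𝕜 := ℝ) j) z)
    (hvs : ContDiffAt ℝ (2 * m : ℕ) v x₀) (hvb : ∃ M, ∀ z, ‖v z‖ ≤ M)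
    (hwc : ∀ j, Continuous (w j)) (hws : ∀ j, ContDiffAt ℝ (2 * m : ℕ) (w j) x₀)
    (hwb : ∀ j, ∃ M, ∀ z, ‖w j z‖ ≤ M) (i : Fin n) :
    fderiv ℝ (Lms n m s v) x₀ (EuclideanSpace.single i 1) = Lms n m s (w i) x₀ := by
  have hvc : Continuous v := continuous_iff_continuousAt.2 fun z => (hv z).continuousAt
  choose K hK using fun j => exists_abs_finDiff_le (hws j) (hwb j)
  have hK' := eventually_all.2 hK
  have hwi := fun j => integrable_finDiff hn hs hm (hwc j) (hws j) (hwb j)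
  have hbi := integrable_min_pow_div_rpow hn hs hm
  have hvi := integrable_finDiff hn hs hm hvc hvs hvb
  have hL : Lms n m s v = fun x => cnms n m s / 2 *
      ∫ y, finDiff n m v x y / ‖y‖ ^ ((n : ℝ) + 2 * s) := rfl
  rw [hL, Lms]
  generalize (n : ℝ) + 2 * s = p at *
  obtain ⟨F', hF'⟩ : ∃ F' : EuclideanSpace ℝ (Fin n) → EuclideanSpace ℝ (Fin n) →
      EuclideanSpace ℝ (Fin n) →L[ℝ] ℝ, ∀ x y, F' x y =
    ∑ j, (finDiff n m (w j) x y / ‖y‖ ^ p) • EuclideanSpace.proj (𝕜 := ℝ) j := ⟨_, fun _ _ => rfl⟩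
  have hF'i : Integrable (F' x₀) := by
    rw [funext (hF' x₀)]
    exact integrable_sum_smul_const hwi _
  have hmeas : ∀ᶠ x in nhds x₀,
      AEStronglyMeasurable (fun y => finDiff n m v x y / ‖y‖ ^ p) volume :=
    Eventually.of_forall fun x => ((continuous_finDiff hvc x).measurable.div
      (measurable_norm.pow_const _)).aestronglyMeasurable
  have hbound : ∀ y, ∀ x ∈ {x | ∀ j y, |finDiff n m (w j) x y| ≤ K j * min (‖y‖ ^ (2 * m)) 1},
      ‖F' x y‖ ≤ ∑ j, K j * (min (‖y‖ ^ (2 * m)) 1 / ‖y‖ ^ p) *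
        ‖EuclideanSpace.proj (𝕜 := ℝ) (ι := Fin n) j‖ := fun y x hx => by
    rw [hF']
    refine (norm_sum_le _ _).trans (Finset.sum_le_sum fun j _ => ?_)
    rw [norm_smul, Real.norm_eq_abs, abs_div, abs_of_nonneg (a := ‖y‖ ^ _) (by positivity),
      ← mul_div_assoc]
    gcongr
    exact hx j y
  have hboundi : Integrable fun y : EuclideanSpace ℝ (Fin n) =>
      ∑ j, K j * (min (‖y‖ ^ (2 * m)) 1 / ‖y‖ ^ p) *
        ‖EuclideanSpace.proj (𝕜 := ℝ) (ι := Fin n) j‖ :=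
    integrable_finsetSum _ fun j _ => (hbi.const_mul _).mul_const _
  have hdiff : ∀ y x, HasFDerivAt (fun x => finDiff n m v x y / ‖y‖ ^ p) (F' x y) x :=
    fun y x => by
    simp only [div_eq_inv_mul]
    refine ((hasFDerivAt_finDiff hv x y).const_mul _).congr_fderiv ?_
    simp only [hF', Finset.smul_sum, smul_smul, div_eq_inv_mul]
  have key := hasFDerivAt_integral_of_dominated_of_fderiv_le hK' hmeas hvi
    hF'i.aestronglyMeasurable (ae_of_all _ hbound) hboundi (ae_of_all _ fun y x _ => hdiff y x)
  rw [(key.const_mul (cnms n m s / 2)).fderiv, _root_.smul_apply,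
    ContinuousLinearMap.integral_apply hF'i, smul_eq_mul]
  congr 2
  ext y
  simp [hF']

theorem Lms_linear_comb {n m : ℕ} {s : ℝ} (hn : 0 < n) (hs : 0 < s) (hm : s < m)
    {u v : EuclideanSpace ℝ (Fin n) → ℝ} {x₀ : EuclideanSpace ℝ (Fin n)}
    (huc : Continuous u) (hu : ContDiffAt ℝ (2 * m : ℕ) u x₀) (hub : ∃ M, ∀ z, ‖u z‖ ≤ M)
    (hvc : Continuous v) (hv : ContDiffAt ℝ (2 * m : ℕ) v x₀) (hvb : ∃ M, ∀ z, ‖v z‖ ≤ M)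
    (c d : ℝ) :
    Lms n m s (fun z => c * u z + d * v z) x₀ = c * Lms n m s u x₀ + d * Lms n m s v x₀ := by
  have h : ∀ y, finDiff n m (fun z => c * u z + d * v z) x₀ y / ‖y‖ ^ ((n : ℝ) + 2 * s) =
      c * (finDiff n m u x₀ y / ‖y‖ ^ ((n : ℝ) + 2 * s)) +
        d * (finDiff n m v x₀ y / ‖y‖ ^ ((n : ℝ) + 2 * s)) := fun y => by
    rw [← mul_div_assoc, ← mul_div_assoc, ← add_div]
    congr 1
    simp only [finDiff, Finset.mul_sum, ← Finset.sum_add_distrib]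
    refine Finset.sum_congr rfl fun k _ => ?_
    ring
  simp only [Lms, h]
  rw [integral_add ((integrable_finDiff hn hs hm huc hu hub).const_mul c)
    ((integrable_finDiff hn hs hm hvc hv hvb).const_mul d), integral_const_mul, integral_const_mul]
  ring

theorem continuous_qa (n : ℕ) (a : Fin n → ℝ) : Continuous (qa n a) := by
  unfold qa
  fun_prop

theorem contDiff_coord {n : ℕ} {N : WithTop ℕ∞} (j : Fin n) :
    ContDiff ℝ N fun z : EuclideanSpace ℝ (Fin n) => z j :=
  (EuclideanSpace.proj (𝕜 := ℝ) j : EuclideanSpace ℝ (Fin n) →L[ℝ] ℝ).contDiff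

theorem hasFDerivAt_qa (n : ℕ) (a : Fin n → ℝ) (z : EuclideanSpace ℝ (Fin n)) :
    HasFDerivAt (qa n a) (∑ j, (2 * a j * z j) • EuclideanSpace.proj (𝕜 := ℝ) j) z := by
  unfold qa
  refine (HasFDerivAt.fun_sum fun j _ => (((EuclideanSpace.proj (𝕜 := ℝ) j :
    EuclideanSpace ℝ (Fin n) →L[ℝ] ℝ).hasFDerivAt (x := z)).pow 2).const_mul
      (a j)).congr_fderiv ?_
  refine Finset.sum_congr rfl fun j _ => ?_
  ext v
  simp
  ring

theorem continuous_uPow {n : ℕ} {a : Fin n → ℝ} {γ : ℝ} (hγ : 0 < γ) :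
    Continuous (uPow n a γ) :=
  (continuous_const.max (continuous_const.sub (continuous_qa n a))).rpow_const
    fun _ => Or.inr hγ.le

theorem contDiffAt_uPow {n : ℕ} {N : ℕ} {a : Fin n → ℝ} {γ : ℝ} {x : EuclideanSpace ℝ (Fin n)}
    (hx : x ∈ Ea n a) : ContDiffAt ℝ N (uPow n a γ) x := by
  have hx1 : qa n a x < 1 := hx
  have hq : ContDiff ℝ N (qa n a) := by
    unfold qa
    exact ContDiff.sum fun j _ => contDiff_const.mul ((contDiff_coord j).pow 2)
  refine ((contDiffAt_const.sub hq.contDiffAt).rpow_const_of_ne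
    (p := γ) (sub_pos.2 hx1).ne').congr_of_eventuallyEq ?_
  filter_upwards [(continuous_qa n a).continuousAt.eventually_lt_const hx1] with z hz
  rw [uPow, max_eq_right (sub_pos.2 hz).le]

theorem hasCompactSupport_uPow {n : ℕ} {a : Fin n → ℝ} (ha : ∀ i, 0 < a i) {γ : ℝ} (hγ : 0 < γ) :
    HasCompactSupport (uPow n a γ) := by
  refine HasCompactSupport.intro (isCompact_closedBall 0 √(∑ i, 1 / a i)) fun z hz => ?_
  have hq : 1 ≤ qa n a z := by
    by_contra! h
    refine hz (mem_closedBall_zero_iff.2 ?_)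
    rw [EuclideanSpace.norm_eq]
    refine Real.sqrt_le_sqrt (Finset.sum_le_sum fun i _ => ?_)
    rw [le_div_iff₀ (ha i), Real.norm_eq_abs, sq_abs, mul_comm]
    exact (Finset.single_le_sum (f := fun i => a i * z i ^ 2)
      (fun j _ => mul_nonneg (ha j).le (sq_nonneg _)) (Finset.mem_univ i)).trans h.le
  rw [uPow, max_eq_left (by linarith), Real.zero_rpow hγ.ne']

theorem exists_norm_mul_uPow_le {n : ℕ} {a : Fin n → ℝ} (ha : ∀ i, 0 < a i) {γ : ℝ} (hγ : 0 < γ)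
    {f : EuclideanSpace ℝ (Fin n) → ℝ} (hf : Continuous f) :
    ∃ M, ∀ z, ‖f z * uPow n a γ z‖ ≤ M :=
  (hf.mul (continuous_uPow hγ)).bounded_above_of_compact_support
    (hasCompactSupport_uPow ha hγ).mul_left

theorem hasDerivAt_max_zero_rpow {γ : ℝ} (hγ : 0 < γ) (t : ℝ) :
    HasDerivAt (fun t : ℝ => max 0 t ^ (γ + 1)) ((γ + 1) * max 0 t ^ γ) t := by
  have hc : ∀ p : ℝ, 0 < p → Continuous fun t : ℝ => max 0 t ^ p := fun p hp =>
    (continuous_const.max continuous_id).rpow_const fun _ => Or.inr hp.le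
  refine hasDerivAt_of_hasDerivAt_of_ne' (x := 0) (g := fun t : ℝ => (γ + 1) * max 0 t ^ γ)
    (fun y hy => ?_) (hc _ (by linarith)).continuousAt
    (continuous_const.mul (hc _ hγ)).continuousAt t
  rcases lt_or_gt_of_ne hy with hy | hy
  · rw [max_eq_left hy.le, Real.zero_rpow hγ.ne', mul_zero]
    refine (hasDerivAt_const y (0 : ℝ)).congr_of_eventuallyEq ?_
    filter_upwards [gt_mem_nhds hy] with r hr
    rw [max_eq_left hr.le, Real.zero_rpow (by linarith)]
  · have h := Real.hasDerivAt_rpow_const (p := γ + 1) (Or.inl hy.ne')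
    rw [add_sub_cancel_right] at h
    rw [max_eq_right hy.le]
    refine h.congr_of_eventuallyEq ?_
    filter_upwards [lt_mem_nhds hy] with r hr
    rw [max_eq_right hr.le]

theorem hasFDerivAt_uPow {n : ℕ} (a : Fin n → ℝ) {γ : ℝ} (hγ : 0 < γ)
    (z : EuclideanSpace ℝ (Fin n)) :
    HasFDerivAt (uPow n a (γ + 1))
      (∑ j, (-(2 * (γ + 1) * a j) * z j * uPow n a γ z) • EuclideanSpace.proj (𝕜 := ℝ) j) z := by
  refine ((hasDerivAt_max_zero_rpow hγ (1 - qa n a z)).comp_hasFDerivAt z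
    ((hasFDerivAt_qa n a z).const_sub 1)).congr_fderiv ?_
  rw [← Finset.sum_neg_distrib, Finset.smul_sum]
  refine Finset.sum_congr rfl fun j _ => ?_
  rw [← neg_smul, smul_smul, uPow]
  congr 1
  ring

theorem hasFDerivAt_coord_mul_uPow {n : ℕ} (a : Fin n → ℝ) {γ : ℝ} (hγ : 0 < γ) (c : ℝ) (j : Fin n)
    (z : EuclideanSpace ℝ (Fin n)) :
    HasFDerivAt (fun z => c * z j * uPow n a (γ + 1) z)
      (∑ l, (c * (if l = j then 1 else 0) * uPow n a (γ + 1) z +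
        -(2 * (γ + 1) * c * a l) * (z l * z j * uPow n a γ z)) •
          EuclideanSpace.proj (𝕜 := ℝ) l) z := by
  refine ((((EuclideanSpace.proj (𝕜 := ℝ) j :
    EuclideanSpace ℝ (Fin n) →L[ℝ] ℝ).hasFDerivAt (x := z)).const_mul c).mul
      (hasFDerivAt_uPow a hγ z)).congr_fderiv ?_
  simp only [add_smul, Finset.sum_add_distrib, Finset.smul_sum, smul_smul]
  rw [add_comm]
  congr 1
  · simp [mul_comm]
  · refine Finset.sum_congr rfl fun l _ => ?_
    congr 1
    simp only [PiLp.proj_apply]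
    ring

/-- recurrence for `(-Δ)^s (xᵢ xⱼ u_β)`. -/
theorem statement7 (n m : ℕ) (s β : ℝ) (hn : 2 ≤ n) (hs : 0 < s) (hβ : 0 < β) (hm : s < m)
    (a : Fin n → ℝ) (ha : ∀ i, 0 < a i) (i j : Fin n) :
    ∀ x ∈ Ea n a,
      Lms n m s (fun y => y i * y j * uPow n a β y) x =
        1 / (2 * (β + 1) * a i) *
          ((if i = j then (1 : ℝ) else 0) * Lms n m s (uPow n a (β + 1)) x +
            1 / (2 * (β + 2) * a j) *
              fderiv ℝ (fun z =>
                  fderiv ℝ (Lms n m s (uPow n a (β + 2))) z (EuclideanSpace.single j 1)) x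
                (EuclideanSpace.single i 1)) := by
  intro x hx
  have hn0 : 0 < n := by omega
  have hβ1 : 0 < β + 1 := by linarith
  have hβ2 : β + 2 = β + 1 + 1 := by ring
  have hEa : ∀ᶠ z in nhds x, z ∈ Ea n a :=
    (continuous_qa n a).continuousAt.eventually_lt_const hx
  have hcoord : ∀ l : Fin n, Continuous fun z : EuclideanSpace ℝ (Fin n) => z l := by fun_prop
  have hub := exists_norm_mul_uPow_le ha hβ1 (f := fun _ => 1) continuous_const
  have hub2 := exists_norm_mul_uPow_le ha (γ := β + 1 + 1) (by linarith) (f := fun _ => 1)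
    continuous_const
  simp only [one_mul] at hub hub2
  have hc1 : ∀ (c : ℝ) (l : Fin n), Continuous fun z => c * z l * uPow n a (β + 1) z :=
    fun c l => (continuous_const.mul (hcoord l)).mul (continuous_uPow hβ1)
  have hs1 : ∀ (c : ℝ) (l : Fin n), ∀ z ∈ Ea n a,
      ContDiffAt ℝ (2 * m : ℕ) (fun z => c * z l * uPow n a (β + 1) z) z := fun c l z hz =>
    (contDiffAt_const.mul (contDiff_coord l).contDiffAt).mul (contDiffAt_uPow hz)
  have hb1 : ∀ (c : ℝ) (l : Fin n), ∃ M, ∀ z, ‖c * z l * uPow n a (β + 1) z‖ ≤ M :=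
    fun c l => exists_norm_mul_uPow_le ha hβ1 (continuous_const.mul (hcoord l))
  have hc2 : ∀ l, Continuous fun z => z l * z j * uPow n a β z :=
    fun l => ((hcoord l).mul (hcoord j)).mul (continuous_uPow hβ)
  have hs2 : ∀ l, ContDiffAt ℝ (2 * m : ℕ) (fun z => z l * z j * uPow n a β z) x := fun l =>
    ((contDiff_coord l).contDiffAt.mul (contDiff_coord j).contDiffAt).mul (contDiffAt_uPow hx)
  have hb2 : ∀ l, ∃ M, ∀ z, ‖z l * z j * uPow n a β z‖ ≤ M :=
    fun l => exists_norm_mul_uPow_le ha hβ ((hcoord l).mul (hcoord j))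
  have hfirst : (fun z => fderiv ℝ (Lms n m s (uPow n a (β + 2))) z (EuclideanSpace.single j 1))
      =ᶠ[nhds x] Lms n m s fun z => -(2 * (β + 1 + 1) * a j) * z j * uPow n a (β + 1) z := by
    filter_upwards [hEa] with z hz
    rw [hβ2]
    exact fderiv_Lms_single hn0 hs hm (hasFDerivAt_uPow a hβ1) (contDiffAt_uPow hz) hub2
      (fun l => hc1 _ l) (fun l => hs1 _ l z hz) (fun l => hb1 _ l) j
  rw [hfirst.fderiv_eq, fderiv_Lms_single hn0 hs hm
    (hasFDerivAt_coord_mul_uPow a hβ (-(2 * (β + 1 + 1) * a j)) j) (hs1 _ j x hx) (hb1 _ j)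
    (fun l => (continuous_const.mul (continuous_uPow hβ1)).add (continuous_const.mul (hc2 l)))
    (fun l => (contDiffAt_const.mul (contDiffAt_uPow hx)).add (contDiffAt_const.mul (hs2 l)))
    (fun l => ?_) i,
    Lms_linear_comb hn0 hs hm (continuous_uPow hβ1) (contDiffAt_uPow hx) hub (hc2 i) (hs2 i)
      (hb2 i)]
  · have hai := (ha i).ne'
    have haj := (ha j).ne'
    have h1 : β + 1 ≠ 0 := hβ1.ne'
    have h2 : β + 2 ≠ 0 := by linarith
    rw [← hβ2]
    field_simp
    ring
  · obtain ⟨M, hM⟩ := hub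
    obtain ⟨M', hM'⟩ := hb2 l
    refine ⟨‖-(2 * (β + 1 + 1) * a j) * (if l = j then (1 : ℝ) else 0)‖ * M +
      ‖-(2 * (β + 1) * -(2 * (β + 1 + 1) * a j) * a l)‖ * M', fun z => ?_⟩
    refine (norm_add_le _ _).trans ?_
    rw [norm_mul _ (uPow n a (β + 1) z), norm_mul _ (z l * z j * uPow n a β z)]
    gcongr
    · exact hM z
    · exact hM' z
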